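/- The operator Λ = −i ∂_φ M_{cos θ} (I + 6Δ^{−1}) on L²₀(S²) (square-integrable functions with zero mean on the unit sphere) has no eigenvalues in ℂ∖{0}. -/

import Mathlib

open Real

/-- Eigenvalue `λ_n = n(n+1)` of `−Δ` on the unit sphere `S²`. -/
def lam (n : ℕ) : ℝ := n * (n + 1)

/-- The recurrence coefficient `a_n^m = √((n−m)(n+m)/((2n−1)(2n+1)))` in
`cos θ · Y_n^m = a_n^m Y_{n−1}^m + a_{n+1}^m Y_{n+1}^m`. -/
noncomputable def aCoef (n : ℕ) (m : ℤ) : ℝ :=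
  Real.sqrt ((((n : ℝ) - (m : ℝ)) * ((n : ℝ) + (m : ℝ))) / ((2 * (n : ℝ) - 1) * (2 * (n : ℝ) + 1)))

open Filter Topology

/-- A square-summable solution of a Jacobi-type recurrence whose coefficients converge
sufficiently regularly to those of the free recurrence vanishes eventually, when the spectral
parameter lies in the interior of the essential spectrum. -/
theorem eventually_eq_zero_of_jacobi {x : ℝ} (hx : |x| < 1) {a e d : ℕ → ℝ}
    (ha : Tendsto a atTop (𝓝 (1 / 2))) (hmono : ∀ᶠ n in atTop, a n ≤ a (n + 1))
    (he : Tendsto e atTop (𝓝 1))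
    (hde : Tendsto (fun n : ℕ => ((n : ℝ) + 1) * (e (n + 1) - e n)) atTop (𝓝 0))
    (hrec : ∀ᶠ n in atTop, x * e (n + 1) * d (n + 1) = a (n + 2) * d (n + 2) + a (n + 1) * d n)
    (hd : Summable fun n => d n ^ 2) :
    ∀ᶠ n in atTop, d n = 0 := by
  set P : ℕ → ℝ := fun n =>
    a (n + 1) ^ 2 * d (n + 1) ^ 2 - x * e n * a (n + 1) * d n * d (n + 1) + a n ^ 2 * d n ^ 2
    with hP
  set q : ℕ → ℝ := fun n => d n ^ 2 + d (n + 1) ^ 2 with hq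
  have hqs : Summable q := hd.add ((summable_nat_add_iff (f := fun n => d n ^ 2) 1).2 hd)
  obtain ⟨δ, hδ⟩ : ∃ δ : ℝ, δ = (1 - |x|) / 16 := ⟨_, rfl⟩
  have hx0 := abs_nonneg x
  have hδ0 : 0 < δ := by rw [hδ]; linarith
  have ha1 : Tendsto (fun n => a (n + 1)) atTop (𝓝 (1 / 2)) := (tendsto_add_atTop_iff_nat 1).2 ha
  have t1 : ∀ᶠ n in atTop, |a n ^ 2 - 1 / 4| < δ := by
    have := ha.pow 2
    norm_num at this
    simpa [Real.dist_eq] using Metric.tendsto_nhds.1 this δ hδ0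
  have t2 : ∀ᶠ n in atTop, |a (n + 1) ^ 2 - 1 / 4| < δ :=
    (tendsto_add_atTop_nat 1).eventually t1
  have t3 : ∀ᶠ n in atTop, |e n * a (n + 1) - 1 / 2| < δ := by
    have := he.mul ha1
    rw [one_mul] at this
    simpa [Real.dist_eq] using Metric.tendsto_nhds.1 this δ hδ0
  have t4 : ∀ᶠ n : ℕ in atTop, |((n : ℝ) + 1) * (e (n + 1) - e n)| < δ := by
    simpa [Real.dist_eq] using Metric.tendsto_nhds.1 hde δ hδ0
  have t5 : ∀ᶠ n in atTop, 0 < a n := ha.eventually (lt_mem_nhds (by norm_num))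
  have t6 : ∀ᶠ n in atTop, a (n + 1) < 1 := ha1.eventually (gt_mem_nhds (by norm_num))
  have bounds : ∀ᶠ n : ℕ in atTop, δ * q n ≤ P n ∧ P n ≤ q n ∧
      (n : ℝ) * P n ≤ ((n + 1 : ℕ) : ℝ) * P (n + 1) := by
    filter_upwards [t1, t2, t3, t4, t5, t6, hmono, hrec] with n h1 h2 h3 h4 h5 h6 h7 h8
    have hq0 : 0 ≤ q n := by positivity
    have hdd : |d n * d (n + 1)| ≤ q n / 2 := by
      rw [abs_le]
      constructor <;> simp only [hq] <;>
        nlinarith [sq_nonneg (d n + d (n + 1)), sq_nonneg (d n - d (n + 1))]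
    have hPq : P n = q n / 4 - x * (d n * d (n + 1)) / 2
        + ((a (n + 1) ^ 2 - 1 / 4) * d (n + 1) ^ 2 + (a n ^ 2 - 1 / 4) * d n ^ 2)
        - x * ((e n * a (n + 1) - 1 / 2) * (d n * d (n + 1))) := by
      simp only [hP, hq]; ring
    have b1 : |x * (d n * d (n + 1))| ≤ |x| * (q n / 2) := by
      rw [abs_mul]; gcongr
    have b2 : |(a (n + 1) ^ 2 - 1 / 4) * d (n + 1) ^ 2 + (a n ^ 2 - 1 / 4) * d n ^ 2|
        ≤ δ * q n := by
      refine (abs_add_le _ _).trans ?_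
      rw [abs_mul, abs_mul, abs_of_nonneg (sq_nonneg (d n)), abs_of_nonneg (sq_nonneg (d (n + 1)))]
      simp only [hq]
      nlinarith [mul_le_mul_of_nonneg_right h1.le (sq_nonneg (d n)),
        mul_le_mul_of_nonneg_right h2.le (sq_nonneg (d (n + 1)))]
    have b3 : |x * ((e n * a (n + 1) - 1 / 2) * (d n * d (n + 1)))| ≤ 1 * (δ * (q n / 2)) := by
      rw [abs_mul, abs_mul]; gcongr
    have b1' := abs_le.1 b1
    have b2' := abs_le.1 b2
    have b3' := abs_le.1 b3
    have hxq : |x| * q n = q n - 16 * (δ * q n) := by rw [hδ]; ring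
    have hδq : 0 ≤ δ * q n := by positivity
    have hδq' : 16 * (δ * q n) ≤ q n := by
      have : 0 ≤ |x| * q n := by positivity
      linarith
    have hlow : δ * q n ≤ P n := by rw [hPq]; linarith
    refine ⟨hlow, by rw [hPq]; linarith, ?_⟩
    have hdiff : P (n + 1) - P n = (a (n + 1) ^ 2 - a n ^ 2) * d n ^ 2
        - x * (e (n + 1) - e n) * a (n + 1) * (d n * d (n + 1)) := by
      have h9 : a (n + 2) * d (n + 2) = x * e (n + 1) * d (n + 1) - a (n + 1) * d n := by
        linarith
      have : P (n + 1) = (a (n + 2) * d (n + 2)) ^ 2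
          - x * e (n + 1) * d (n + 1) * (a (n + 2) * d (n + 2)) + a (n + 1) ^ 2 * d (n + 1) ^ 2 := by
        simp only [hP, add_assoc, Nat.reduceAdd]; ring
      rw [this, h9]
      simp only [hP]
      ring
    have b4 : |x * (((n : ℝ) + 1) * (e (n + 1) - e n)) * a (n + 1) * (d n * d (n + 1))|
        ≤ 1 * δ * 1 * (q n / 2) := by
      have ha_pos : 0 < a (n + 1) := h5.trans_le h7
      rw [abs_mul, abs_mul, abs_mul x, abs_of_pos ha_pos]
      gcongr
    have b4' := abs_le.1 b4
    have hsq : 0 ≤ ((n : ℝ) + 1) * ((a (n + 1) ^ 2 - a n ^ 2) * d n ^ 2) := by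
      have : a n ^ 2 ≤ a (n + 1) ^ 2 := by gcongr
      have : 0 ≤ a (n + 1) ^ 2 - a n ^ 2 := by linarith
      positivity
    have hfin : ((n + 1 : ℕ) : ℝ) * P (n + 1) - (n : ℝ) * P n
        = P n + ((n : ℝ) + 1) * ((a (n + 1) ^ 2 - a n ^ 2) * d n ^ 2)
          - x * (((n : ℝ) + 1) * (e (n + 1) - e n)) * a (n + 1) * (d n * d (n + 1)) := by
      push_cast
      linear_combination ((n : ℝ) + 1) * hdiff
    linarith
  obtain ⟨M, hM⟩ := eventually_atTop.1 bounds
  refine eventually_atTop.2 ⟨M + 1, fun n hn => ?_⟩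
  by_contra hne
  have hPn : 0 < P n := by
    refine lt_of_lt_of_le ?_ (hM n (by omega)).1
    have : 0 < d n ^ 2 := by positivity
    simp only [hq]
    positivity
  have hn0 : (0 : ℝ) < n := by
    have : 0 < n := by omega
    exact_mod_cast this
  have hgrow : ∀ k, n ≤ k → (n : ℝ) * P n ≤ (k : ℝ) * P k := by
    intro k hk
    induction k, hk using Nat.le_induction with
    | base => exact le_rfl
    | succ k hk ih => exact ih.trans (hM k (by omega)).2.2
  have hc : 0 < (n : ℝ) * P n := by positivity
  have hs : Summable fun k : ℕ => (n : ℝ) * P n * (1 / ((k + n : ℕ) : ℝ)) := by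
    refine Summable.of_nonneg_of_le (fun k => by positivity) (fun k => ?_)
      ((summable_nat_add_iff n).2 hqs)
    have hk0 : (0 : ℝ) < ((k + n : ℕ) : ℝ) := by
      push_cast; positivity
    have h1 := hgrow (k + n) (by omega)
    have h2 := (hM (k + n) (by omega)).2.1
    rw [mul_one_div, div_le_iff₀ hk0]
    nlinarith
  rw [summable_mul_left_iff hc.ne', summable_nat_add_iff (f := fun k : ℕ => 1 / (k : ℝ)) n] at hs
  exact Real.not_summable_one_div_natCast hs

/-- An eigenvalue of a half-line Jacobi operator symmetrized by weights in `(0, 1)`, with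
off-diagonal entries at most `1 / 2`, is real and lies in `(-1, 1)`. -/
theorem im_eq_zero_and_abs_re_lt_one_of_jacobi {ν : ℂ} {A B : ℕ → ℝ} {C : ℕ → ℂ}
    (hA0 : ∀ k, 0 ≤ A k) (hA : ∀ k, A k ≤ 1 / 2) (hB0 : ∀ k, 0 < B k) (hB : ∀ k, B k < 1)
    (hC : Summable fun k => ‖C k‖ ^ 2)
    (h0 : ν * C 0 = A 1 * B 1 * C 1)
    (hrec : ∀ k, ν * C (k + 1) = A (k + 2) * B (k + 2) * C (k + 2) + A (k + 1) * B k * C k)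
    (hne : ∃ k, C k ≠ 0) : ν.im = 0 ∧ |ν.re| < 1 := by
  set T : ℕ → ℂ := fun k => A (k + 1) * B (k + 1) * B k * (C (k + 1) * star (C k)) with hT
  set w : ℕ → ℝ := fun k => B k ^ 2 * ‖C k‖ ^ 2 with hw
  set s : ℕ → ℝ := fun k => B k * ‖C k‖ ^ 2 with hs
  have hss : Summable s := hC.of_nonneg_of_le
    (fun k => mul_nonneg (hB0 k).le (sq_nonneg _))
    (fun k => by nlinarith [sq_nonneg ‖C k‖, hB k])
  have hws_le : ∀ k, w k ≤ s k := fun k => by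
    simp only [hw, hs]
    have : B k ^ 2 ≤ B k := by nlinarith [hB k, hB0 k]
    gcongr
  have hws : Summable w := hss.of_nonneg_of_le (fun k => by positivity) hws_le
  have hws1 : Summable fun k => w (k + 1) := (summable_nat_add_iff 1).2 hws
  have hTle : ∀ k, ‖T k‖ ≤ (w (k + 1) + w k) / 4 := fun k => by
    simp only [hT, hw, norm_mul, Complex.norm_real, norm_star, Real.norm_eq_abs,
      abs_of_nonneg (hA0 _), abs_of_pos (hB0 _)]
    have h1 := hA (k + 1)
    have h2 : 0 ≤ B (k + 1) * ‖C (k + 1)‖ * (B k * ‖C k‖) := by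
      have := hB0 k
      have := hB0 (k + 1)
      positivity
    nlinarith [mul_le_mul_of_nonneg_right h1 h2,
      sq_nonneg (B (k + 1) * ‖C (k + 1)‖ - B k * ‖C k‖)]
  have hTn : Summable fun k => ‖T k‖ :=
    ((hws1.add hws).div_const 4).of_nonneg_of_le (fun k => norm_nonneg _) hTle
  have hTs : Summable T := hTn.of_norm
  have hcc : ∀ k, C k * star (C k) = ((‖C k‖ ^ 2 : ℝ) : ℂ) := fun k => by
    have := Complex.mul_conj' (C k)
    push_cast
    exact this
  have e0 : ν * (s 0 : ℂ) = T 0 := by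
    simp only [hs, hT, Complex.ofReal_mul, ← hcc]
    linear_combination (B 0 : ℂ) * star (C 0) * h0
  have e1 : ∀ k, ν * (s (k + 1) : ℂ) = T (k + 1) + star (T k) := fun k => by
    simp only [hs, hT, Complex.ofReal_mul, ← hcc, star_mul', star_star]
    simp only [Complex.star_def, Complex.conj_ofReal]
    have := hrec k
    linear_combination (B (k + 1) : ℂ) * (starRingEnd ℂ) (C (k + 1)) * this
  have hsc : Summable fun k => ν * (s k : ℂ) := (Complex.summable_ofReal.2 hss).mul_left ν
  have key : ν * ((∑' k, s k : ℝ) : ℂ) = (∑' k, T k) + star (∑' k, T k) := by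
    rw [Complex.ofReal_tsum, ← tsum_mul_left, hsc.tsum_eq_zero_add, e0]
    simp only [e1]
    rw [((summable_nat_add_iff 1).2 hTs).tsum_add hTs.star, ← tsum_star, ← add_assoc,
      ← hTs.tsum_eq_zero_add]
  obtain ⟨k₀, hk₀⟩ := hne
  have hlt : ∑' k, w k < ∑' k, s k := by
    refine Summable.tsum_lt_tsum (i := k₀) hws_le ?_ hws hss
    simp only [hw, hs]
    have : B k₀ ^ 2 < B k₀ := by nlinarith [hB k₀, hB0 k₀]
    have : 0 < ‖C k₀‖ := norm_pos_iff.2 hk₀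
    gcongr
  have hw0 : 0 ≤ ∑' k, w k := tsum_nonneg fun k => by positivity
  have hS : 0 < ∑' k, s k := hw0.trans_lt hlt
  have hTsum : ‖∑' k, T k‖ ≤ (∑' k, w k) / 2 := by
    calc ‖∑' k, T k‖ ≤ ∑' k, ‖T k‖ := norm_tsum_le_tsum_norm hTn
      _ ≤ ∑' k, (w (k + 1) + w k) / 4 := hTn.tsum_le_tsum hTle ((hws1.add hws).div_const 4)
      _ = ((∑' k, w (k + 1)) + ∑' k, w k) / 4 := by rw [tsum_div_const, hws1.tsum_add hws]
      _ ≤ (∑' k, w k) / 2 := by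
        have := hws.tsum_eq_zero_add
        have : 0 ≤ w 0 := by positivity
        linarith
  have hre := congrArg Complex.re key
  have him := congrArg Complex.im key
  simp only [Complex.mul_re, Complex.mul_im, Complex.ofReal_re, Complex.ofReal_im, mul_zero,
    sub_zero, zero_add, Complex.add_re, Complex.add_im, Complex.star_def, Complex.conj_re,
    Complex.conj_im, add_neg_cancel] at hre him
  refine ⟨(mul_eq_zero.1 him).resolve_right hS.ne', ?_⟩
  have hTre := Complex.abs_re_le_norm (∑' k, T k)
  have : |ν.re| * ∑' k, s k ≤ ∑' k, w k := by
    have habs : |ν.re| * ∑' k, s k = |ν.re * ∑' k, s k| := by rw [abs_mul, abs_of_pos hS]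
    rw [habs, hre, ← two_mul, abs_mul, abs_two]
    linarith
  by_contra! h
  nlinarith

theorem aCoef_nonneg (n : ℕ) (m : ℤ) : 0 ≤ aCoef n m := Real.sqrt_nonneg _

theorem aCoef_eq (n : ℕ) (m : ℤ) :
    aCoef n m = √((1 - ((m : ℝ) ^ 2 - 1 / 4) / ((n : ℝ) ^ 2 - 1 / 4)) / 4) := by
  have h : (n : ℝ) ^ 2 - 1 / 4 ≠ 0 := by
    rcases Nat.eq_zero_or_pos n with rfl | hn
    · norm_num
    · have : (1 : ℝ) ≤ n := by exact_mod_cast hn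
      nlinarith
  have h' : (2 * (n : ℝ) - 1) * (2 * n + 1) = 4 * ((n : ℝ) ^ 2 - 1 / 4) := by ring
  rw [aCoef, h', one_sub_div h, div_div, mul_comm _ (4 : ℝ)]
  congr 2
  ring

theorem one_le_sq_of_ne_zero {m : ℤ} (hm : m ≠ 0) : (1 : ℝ) ≤ (m : ℝ) ^ 2 := by
  have : 0 < m ^ 2 := by positivity
  exact_mod_cast this

theorem aCoef_le_succ {m : ℤ} (hm : m ≠ 0) {n : ℕ} (hn : 1 ≤ n) :
    aCoef n m ≤ aCoef (n + 1) m := by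
  have hn' : (1 : ℝ) ≤ n := by exact_mod_cast hn
  have h1 : 0 ≤ (m : ℝ) ^ 2 - 1 / 4 := by linarith [one_le_sq_of_ne_zero hm]
  have h2 : 0 < (n : ℝ) ^ 2 - 1 / 4 := by nlinarith
  rw [aCoef_eq, aCoef_eq]
  push_cast
  gcongr
  linarith

theorem aCoef_le_half {m : ℤ} (hm : m ≠ 0) {n : ℕ} (hn : 1 ≤ n) : aCoef n m ≤ 1 / 2 := by
  have hn' : (1 : ℝ) ≤ n := by exact_mod_cast hn
  have h1 : 0 ≤ (m : ℝ) ^ 2 - 1 / 4 := by linarith [one_le_sq_of_ne_zero hm]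
  have h2 : 0 < (n : ℝ) ^ 2 - 1 / 4 := by nlinarith
  rw [aCoef_eq, Real.sqrt_le_left (by norm_num)]
  have := div_nonneg h1 h2.le
  linarith

theorem aCoef_pos {m : ℤ} {n : ℕ} (hn : m.natAbs < n) : 0 < aCoef n m := by
  have h1 : |(m : ℝ)| < n := by
    rw [← Int.cast_abs, Int.abs_eq_natAbs]
    exact_mod_cast hn
  have hn' : (1 : ℝ) ≤ n := by exact_mod_cast (by omega : 1 ≤ n)
  have h2 := abs_lt.1 h1
  exact Real.sqrt_pos.2 (div_pos (mul_pos (by linarith) (by linarith))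
    (mul_pos (by linarith) (by linarith)))

theorem aCoef_natAbs (m : ℤ) : aCoef m.natAbs m = 0 := by
  have h : ((m.natAbs : ℝ) - m) * (m.natAbs + m) = 0 := by
    have : ((m.natAbs : ℝ)) ^ 2 = (m : ℝ) ^ 2 := by
      rw [Nat.cast_natAbs, Int.cast_abs, sq_abs]
    linear_combination this
  rw [aCoef, h, zero_div, Real.sqrt_zero]

theorem tendsto_aCoef (m : ℤ) : Tendsto (fun n => aCoef n m) atTop (𝓝 (1 / 2)) := by
  simp only [aCoef_eq]
  have h1 : Tendsto (fun n : ℕ => (n : ℝ) ^ 2 - 1 / 4) atTop atTop :=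
    tendsto_atTop_add_const_right _ _
      ((tendsto_pow_atTop two_ne_zero).comp tendsto_natCast_atTop_atTop)
  have h2 := (((h1.const_div_atTop ((m : ℝ) ^ 2 - 1 / 4)).const_sub 1).div_const 4).sqrt
  have h3 : √((1 - 0) / 4) = (1 / 2 : ℝ) := by
    rw [show ((1 - 0) / 4 : ℝ) = (1 / 2) ^ 2 by norm_num, Real.sqrt_sq (by norm_num)]
  rwa [h3] at h2

/-- The factor `1 - 6 / λ_n` lies in `(0, 1)` for `n ≥ 3`. -/
theorem one_sub_six_div_lam_mem_Ioo {n : ℕ} (hn : 3 ≤ n) : 1 - 6 / lam n ∈ Set.Ioo (0 : ℝ) 1 := by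
  have hn' : (3 : ℝ) ≤ n := by exact_mod_cast hn
  have h : 12 ≤ lam n := by rw [lam]; nlinarith
  have h1 : 6 / lam n < 1 := by rw [div_lt_one (by linarith)]; linarith
  have h2 : 0 < 6 / lam n := div_pos (by norm_num) (by linarith)
  constructor <;> linarith

theorem tendsto_one_sub_six_div_lam : Tendsto (fun n => 1 - 6 / lam n) atTop (𝓝 1) := by
  have h1 : Tendsto (fun n : ℕ => lam n) atTop atTop :=
    tendsto_natCast_atTop_atTop.atTop_mul_atTop₀
      (tendsto_atTop_add_const_right _ _ tendsto_natCast_atTop_atTop)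
  simpa using (h1.const_div_atTop 6).const_sub 1

theorem tendsto_succ_mul_inv_sub_inv :
    Tendsto (fun n : ℕ => ((n : ℝ) + 1) * ((1 - 6 / lam (n + 1))⁻¹ - (1 - 6 / lam n)⁻¹))
      atTop (𝓝 0) := by
  have hb := tendsto_one_sub_six_div_lam.inv₀ one_ne_zero
  have hb1 := (tendsto_add_atTop_iff_nat 1).2 hb
  have hn2 : Tendsto (fun n : ℕ => (n : ℝ) * (n + 2)) atTop atTop :=
    tendsto_natCast_atTop_atTop.atTop_mul_atTop₀
      (tendsto_atTop_add_const_right _ _ tendsto_natCast_atTop_atTop)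
  have h := ((hn2.const_div_atTop (-12)).mul hb).mul hb1
  rw [zero_mul, zero_mul] at h
  refine h.congr' ?_
  filter_upwards [eventually_ge_atTop 3] with n hn
  have h1 := (one_sub_six_div_lam_mem_Ioo hn).1.ne'
  have h2 := (one_sub_six_div_lam_mem_Ioo (hn.trans n.le_succ)).1.ne'
  have hn0 : (n : ℝ) ≠ 0 := by
    have : n ≠ 0 := by omega
    exact_mod_cast this
  have hsub : ((n : ℝ) + 1) * ((1 - 6 / lam n) - (1 - 6 / lam (n + 1))) = -12 / (n * (n + 2)) := by
    have : (n : ℝ) + 1 ≠ 0 := by positivity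
    have : (n : ℝ) + 2 ≠ 0 := by positivity
    simp only [lam]
    push_cast
    rw [show (n : ℝ) + 1 + 1 = n + 2 by ring]
    field_simp
    ring
  rw [← hsub, inv_sub_inv h2 h1]
  field_simp

/-- The essential part of the argument: on the range `n ≥ 3`, where the weights `1 - 6 / λ_n`
are positive, the eigenvalue recurrence has no nonzero square-summable solution. -/
theorem eq_zero_of_recurrence {m : ℤ} (hm : m ≠ 0) {ν : ℂ} {u : ℕ → ℂ} {N : ℕ}
    (hN : 3 ≤ N) (hmN : m.natAbs ≤ N) (hu : Summable fun n => ‖u n‖ ^ 2)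
    (h0 : ν * u N = aCoef (N + 1) m * (1 - 6 / lam (N + 1) : ℝ) * u (N + 1))
    (hrec : ∀ n, N ≤ n → ν * u (n + 1) = aCoef (n + 2) m * (1 - 6 / lam (n + 2) : ℝ) * u (n + 2)
      + aCoef (n + 1) m * (1 - 6 / lam n : ℝ) * u n) :
    ∀ n, N ≤ n → u n = 0 := by
  by_contra! hne
  obtain ⟨n₀, hn₀, hne⟩ := hne
  have hb : ∀ n, N ≤ n → 1 - 6 / lam n ∈ Set.Ioo (0 : ℝ) 1 := fun n hn =>
    one_sub_six_div_lam_mem_Ioo (hN.trans hn)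
  obtain ⟨him, hre⟩ := im_eq_zero_and_abs_re_lt_one_of_jacobi (ν := ν)
    (A := fun k => aCoef (N + k) m) (B := fun k => 1 - 6 / lam (N + k)) (C := fun k => u (N + k))
    (fun k => aCoef_nonneg _ _) (fun k => aCoef_le_half hm (by omega))
    (fun k => (hb _ (by omega)).1) (fun k => (hb _ (by omega)).2)
    (by simpa only [add_comm N] using (summable_nat_add_iff N).2 hu) h0
    (fun k => hrec (N + k) (by omega)) ⟨n₀ - N, by rwa [Nat.add_sub_cancel' hn₀]⟩
  have hν : ν = (ν.re : ℂ) := Complex.ext rfl (by simpa using him)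
  have real_case : ∀ v : ℕ → ℝ, (Summable fun n => v n ^ 2) →
      (∀ n, N ≤ n → ν.re * v (n + 1) = aCoef (n + 2) m * (1 - 6 / lam (n + 2)) * v (n + 2)
        + aCoef (n + 1) m * (1 - 6 / lam n) * v n) → ∀ᶠ n in atTop, v n = 0 := by
    intro v hv hvrec
    have hd : ∀ᶠ n in atTop, (1 - 6 / lam n) * v n = 0 := by
      refine eventually_eq_zero_of_jacobi hre (tendsto_aCoef m)
        (eventually_atTop.2 ⟨1, fun n hn => aCoef_le_succ hm hn⟩)
        (by simpa using tendsto_one_sub_six_div_lam.inv₀ one_ne_zero)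
        tendsto_succ_mul_inv_sub_inv ?_ ?_
      · filter_upwards [eventually_ge_atTop N] with n hn
        have h1 := (hb (n + 1) (by omega)).1.ne'
        rw [mul_assoc, inv_mul_cancel_left₀ h1, hvrec n hn]
        ring
      · refine (summable_nat_add_iff N).1 (((summable_nat_add_iff N).2 hv).of_nonneg_of_le
          (fun n => sq_nonneg _) fun n => ?_)
        have h1 := hb (n + N) (by omega)
        rw [mul_pow]
        exact mul_le_of_le_one_left (sq_nonneg _) (pow_le_one₀ h1.1.le h1.2.le)
    filter_upwards [hd, eventually_ge_atTop N] with n hn hnN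
    exact (mul_eq_zero.1 hn).resolve_left (hb n hnN).1.ne'
  have hrev : ∀ᶠ n in atTop, (u n).re = 0 := by
    refine real_case _ (hu.of_nonneg_of_le (fun n => sq_nonneg _) fun n => ?_) fun n hn => ?_
    · exact sq_le_sq.2 (by simpa using Complex.abs_re_le_norm (u n))
    · have := hrec n hn
      rw [hν] at this
      simpa only [← Complex.ofReal_mul, Complex.re_ofReal_mul, Complex.add_re] using
        congrArg Complex.re this
  have himv : ∀ᶠ n in atTop, (u n).im = 0 := by
    refine real_case _ (hu.of_nonneg_of_le (fun n => sq_nonneg _) fun n => ?_) fun n hn => ?_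
    · exact sq_le_sq.2 (by simpa using Complex.abs_im_le_norm (u n))
    · have := hrec n hn
      rw [hν] at this
      simpa only [← Complex.ofReal_mul, Complex.im_ofReal_mul, Complex.add_im] using
        congrArg Complex.im this
  obtain ⟨M, hM⟩ := eventually_atTop.1 (hrev.and himv)
  have hdown : ∀ j n, N ≤ n → M ≤ n + j → u n = 0 := by
    intro j
    induction j with
    | zero => exact fun n _ hn => Complex.ext (hM n hn).1 (hM n hn).2
    | succ j ih =>
      intro n hn hj
      have h := hrec n hn
      rw [ih (n + 1) (by omega) (by omega), ih (n + 2) (by omega) (by omega), mul_zero, mul_zero,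
        zero_add] at h
      have h1 := (aCoef_pos (m := m) (n := n + 1) (by omega)).ne'
      have h2 := (hb n hn).1.ne'
      exact (mul_eq_zero.1 h.symm).resolve_left
        (mul_ne_zero (Complex.ofReal_ne_zero.2 h1) (Complex.ofReal_ne_zero.2 h2))
  exact hne (hdown M n₀ hn₀ (by omega))

/-- Theorem `T:NoEi_Lam` of the paper: the perturbation operator
`Λ = −i ∂_φ M_{cos θ}(I + 6Δ^{−1})` on `L²₀(S²)` has no eigenvalues in `ℂ \ {0}`.
Stated in terms of the coefficients of the expansion
`u = Σ_{m ∈ ℤ} Σ_{n ≥ max(1,|m|)} c_n^m Y_n^m ∈ L²₀(S²)`: since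
`Λ Y_n^m = m(1 − 6/λ_n)(a_n^m Y_{n−1}^m + a_{n+1}^m Y_{n+1}^m)`, the eigenvalue
equation `Λ u = μ u` is equivalent to the stated coefficient recurrence, and the
conclusion `u = 0` says that no `μ ≠ 0` is an eigenvalue. -/
theorem stmt_13 (μ : ℂ) (hμ : μ ≠ 0) (c : ℤ → ℕ → ℂ)
    (hsupp : ∀ (m : ℤ) (n : ℕ), n < max 1 m.natAbs → c m n = 0)
    (hsum : Summable fun p : ℤ × ℕ => ‖c p.1 p.2‖ ^ 2)
    (heig : ∀ (m : ℤ) (n : ℕ), max 1 m.natAbs ≤ n →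
      μ * c m n = (m : ℂ) *
        ((((1 - 6 / lam (n + 1)) * aCoef (n + 1) m : ℝ) : ℂ) * c m (n + 1)
          + (((1 - 6 / lam (n - 1)) * aCoef n m : ℝ) : ℂ) * c m (n - 1))) :
    ∀ m n, c m n = 0 := by
  intro m
  rcases eq_or_ne m 0 with rfl | hm
  · intro n
    rcases lt_or_ge n (max 1 (0 : ℤ).natAbs) with h | h
    · exact hsupp 0 n h
    · simpa [hμ] using heig 0 n h
  have hmC : (m : ℂ) ≠ 0 := Int.cast_ne_zero.2 hm
  have hb2 : 1 - 6 / lam 2 = 0 := by norm_num [lam]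
  have hrec : ∀ n, max 1 m.natAbs ≤ n → μ / m * c m n =
      aCoef (n + 1) m * (1 - 6 / lam (n + 1) : ℝ) * c m (n + 1)
        + aCoef n m * (1 - 6 / lam (n - 1) : ℝ) * c m (n - 1) := by
    intro n hn
    rw [div_mul_eq_mul_div, heig m n hn, mul_div_cancel_left₀ _ hmC]
    push_cast
    ring
  have hbig : ∀ n, max 3 m.natAbs ≤ n → c m n = 0 := by
    refine eq_zero_of_recurrence hm (ν := μ / m) (le_max_left _ _) (le_max_right _ _) ?_ ?_ ?_
    · exact hsum.comp_injective (i := fun n => (m, n)) fun _ _ h => (Prod.mk.inj h).2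
    · rw [hrec _ (by omega), add_eq_left]
      rcases le_total m.natAbs 3 with h | h
      · rw [max_eq_left h, hb2]
        simp
      · rw [max_eq_right h, aCoef_natAbs]
        simp
    · intro n hn
      simpa using hrec (n + 1) (by omega)
  have hsmall : ∀ n, max 1 m.natAbs ≤ n → c m (n + 1) * ((1 - 6 / lam (n + 1) : ℝ) : ℂ) = 0 →
      c m (n - 1) = 0 → c m n = 0 := by
    intro n hn h1 h2
    have h := hrec n hn
    rw [h2, mul_zero, add_zero, mul_assoc, mul_comm _ (c m (n + 1)), h1, mul_zero] at h
    exact (mul_eq_zero.1 h).resolve_left (div_ne_zero hμ hmC)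
  have hc0 : c m 0 = 0 := hsupp m 0 (by omega)
  have hc1 : c m 1 = 0 := by
    rcases lt_or_ge 1 (max 1 m.natAbs) with h | h
    · exact hsupp m 1 h
    · exact hsmall 1 h (by simp [hb2]) hc0
  intro n
  rcases lt_or_ge n (max 1 m.natAbs) with h | h
  · exact hsupp m n h
  rcases le_or_gt 3 n with h3 | h3
  · exact hbig n (by omega)
  interval_cases n
  · exact hc0
  · exact hc1
  · exact hsmall 2 h (by rw [hbig 3 (by omega), zero_mul]) hc1
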